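/- arXiv:1904.05269 — 2 statements merged into one kernel-verified Lean document; each statement's English description precedes it below -/
import Mathlib

section
/- For every integer k ≥ 0, every graph G of treewidth at most k satisfies π*(G) ≤ 4^k. -/
/-- A *lazy walk* in `G` is a sequence of vertices in which any two consecutive vertices
are equal or adjacent. -/
def SimpleGraph.IsLazyWalk {V : Type*} (G : SimpleGraph V) (l : List V) : Prop :=
  l.Chain' fun a b => a = b ∨ G.Adj a b

/-- A colouring `φ` of `G` is *strongly nonrepetitive* if every `φ`-repetitive lazy walk
`v₀, …, v₂ₖ₋₁` (with `k ≥ 1`, repetitive meaning the first half of the colour sequence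
equals the second half) has `vᵢ = vᵢ₊ₖ` for some `i < k`. -/
def SimpleGraph.IsStronglyNonrepetitiveColouring {V α : Type*} (G : SimpleGraph V)
    (φ : V → α) : Prop :=
  ∀ (l : List V) (k : ℕ), G.IsLazyWalk l → 0 < k → l.length = 2 * k →
    (l.map φ).take k = (l.map φ).drop k → ∃ i < k, l[i]? = l[i + k]?

/-- `π*(G)`: the least `n` such that `G` has a strongly nonrepetitive colouring with
`n` colours. -/
noncomputable def SimpleGraph.strongNonrepChromNum {V : Type*} (G : SimpleGraph V) : ℕ :=
  sInf {n : ℕ | ∃ φ : V → Fin n, G.IsStronglyNonrepetitiveColouring φ}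

/-- `(Tg, B)` is a tree-decomposition of `G`: `Tg` is a tree, every vertex of `G` is in
some bag, both endpoints of every edge of `G` lie in a common bag, and for every vertex
`v` of `G` the set of tree nodes whose bag contains `v` induces a (nonempty) connected
subgraph of the tree. -/
def SimpleGraph.IsTreeDecomp {V T : Type*} (G : SimpleGraph V) (Tg : SimpleGraph T)
    (B : T → Finset V) : Prop :=
  Tg.IsTree ∧
  (∀ v : V, ∃ x : T, v ∈ B x) ∧
  (∀ ⦃u v : V⦄, G.Adj u v → ∃ x : T, u ∈ B x ∧ v ∈ B x) ∧
  (∀ v : V, (Tg.induce {x : T | v ∈ B x}).Connected)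

/-- `G` has treewidth at most `k`: it has a tree-decomposition all of whose bags have
at most `k + 1` vertices. -/
def SimpleGraph.HasTreewidthAtMost {V : Type*} (G : SimpleGraph V) (k : ℕ) : Prop :=
  ∃ (T : Type) (Tg : SimpleGraph T) (B : T → Finset V),
    G.IsTreeDecomp Tg B ∧ ∀ x : T, (B x).card ≤ k + 1

/-- The Thue–Morse sequence. -/
def thueMorse (n : ℕ) : Bool :=
  if n = 0 then false else xor (thueMorse (n / 2)) n.bodd

theorem thueMorse_two_mul (n : ℕ) : thueMorse (2 * n) = thueMorse n := by
  rcases Nat.eq_zero_or_pos n with rfl | hn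
  · rfl
  · rw [thueMorse, if_neg (by omega)]
    simp

theorem thueMorse_two_mul_add_one (n : ℕ) : thueMorse (2 * n + 1) = !thueMorse n := by
  rw [thueMorse, if_neg (by omega), show (2 * n + 1) / 2 = n by omega]
  simp

theorem thueMorse_succ_ne_of_even {n : ℕ} (hn : n % 2 = 0) :
    thueMorse n ≠ thueMorse (n + 1) := by
  obtain ⟨m, rfl⟩ : ∃ m, n = 2 * m := ⟨n / 2, by omega⟩
  simp [thueMorse_two_mul, thueMorse_two_mul_add_one]

/-- The Thue–Morse sequence is overlap-free. -/
theorem exists_thueMorse_ne (p : ℕ) (hp : 0 < p) (i : ℕ) :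
    ∃ j ≤ p, thueMorse (i + j) ≠ thueMorse (i + j + p) := by
  induction p using Nat.strong_induction_on generalizing i with
  | _ p ih =>
    by_contra! h
    rcases Nat.even_or_odd' p with ⟨q, rfl | rfl⟩
    · obtain ⟨j, hj, hne⟩ := ih q (by omega) (by omega) (i / 2)
      have := h (2 * j) (by omega)
      rcases Nat.even_or_odd' i with ⟨m, rfl | rfl⟩
      · rw [show 2 * m / 2 = m by omega] at hne
        rw [show 2 * m + 2 * j + 2 * q = 2 * (m + j + q) by ring, ← mul_add,
          thueMorse_two_mul, thueMorse_two_mul] at this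
        exact hne this
      · rw [show (2 * m + 1) / 2 = m by omega] at hne
        rw [show 2 * m + 1 + 2 * j + 2 * q = 2 * (m + j + q) + 1 by ring,
          show 2 * m + 1 + 2 * j = 2 * (m + j) + 1 by ring,
          thueMorse_two_mul_add_one, thueMorse_two_mul_add_one] at this
        exact hne (Bool.not_inj this)
    · have step : ∀ j < 2 * q + 1, thueMorse (i + j) ≠ thueMorse (i + (j + 1)) := by
        intro j hj
        rcases Nat.mod_two_eq_zero_or_one (i + j) with e | e
        · exact thueMorse_succ_ne_of_even e
        · rw [h j hj.le, h (j + 1) hj,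
            show i + (j + 1) + (2 * q + 1) = i + j + (2 * q + 1) + 1 by ring]
          exact thueMorse_succ_ne_of_even (by omega)
      have alt : ∀ j ≤ 2 * q + 1, thueMorse (i + j) = xor (thueMorse i) j.bodd := by
        intro j
        induction j with
        | zero => simp
        | succ j ihj =>
          intro hj
          have h1 := step j hj
          rw [ihj (by omega)] at h1
          rw [Nat.bodd_succ]
          revert h1
          generalize thueMorse (i + (j + 1)) = a
          generalize thueMorse i = b
          generalize j.bodd = c
          revert a b c
          decide
      have h1 := alt (2 * q + 1) le_rfl
      have h2 := h 0 (Nat.zero_le _)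
      simp only [add_zero] at h2
      rw [← h2] at h1
      simp at h1

/-- The ternary square-free word of differences of the Thue–Morse sequence. -/
def ternaryThue (n : ℕ) : Fin 4 :=
  if thueMorse n = thueMorse (n + 1) then 1 else if thueMorse n then 2 else 0

theorem thueMorse_succ_congr {m n : ℕ} (h : ternaryThue m = ternaryThue n) :
    (thueMorse m = thueMorse n ↔ thueMorse (m + 1) = thueMorse (n + 1)) ∧
      (thueMorse m ≠ thueMorse n → thueMorse (m + 1) = thueMorse m) := by
  unfold ternaryThue at h
  revert h
  generalize thueMorse m = a
  generalize thueMorse n = b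
  generalize thueMorse (m + 1) = c
  generalize thueMorse (n + 1) = d
  revert a b c d
  decide

theorem ternaryThue_ne_three (n : ℕ) : ternaryThue n ≠ 3 := by
  unfold ternaryThue
  split_ifs <;> decide

theorem exists_ternaryThue_ne (p : ℕ) (hp : 0 < p) (i : ℕ) :
    ∃ j < p, ternaryThue (i + j) ≠ ternaryThue (i + j + p) := by
  by_contra! h
  have hstep : ∀ j < p,
      (thueMorse (i + j) = thueMorse (i + j + p) ↔
        thueMorse (i + (j + 1)) = thueMorse (i + (j + 1) + p)) ∧
      (thueMorse (i + j) ≠ thueMorse (i + j + p) →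
        thueMorse (i + (j + 1)) = thueMorse (i + j)) := by
    intro j hj
    have := thueMorse_succ_congr (h j hj)
    rwa [show i + j + p + 1 = i + (j + 1) + p by ring, add_assoc i j 1] at this
  by_cases h0 : thueMorse i = thueMorse (i + p)
  · obtain ⟨j, hj, hne⟩ := exists_thueMorse_ne p hp i
    refine hne ?_
    clear hne
    induction j with
    | zero => simpa using h0
    | succ j ih => exact (hstep j hj).1.1 (ih (by omega))
  · have key : ∀ j ≤ p, thueMorse (i + j) ≠ thueMorse (i + j + p) ∧
        thueMorse (i + j) = thueMorse i := by
      intro j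
      induction j with
      | zero => simpa using h0
      | succ j ih =>
        intro hj
        obtain ⟨h1, h2⟩ := ih (by omega)
        obtain ⟨h3, h4⟩ := hstep j hj
        exact ⟨fun e => h1 (h3.2 e), (h4 h1).trans h2⟩
    exact h0 (key p le_rfl).2.symm

theorem ternaryThue_succ_ne (n : ℕ) : ternaryThue n ≠ ternaryThue (n + 1) := by
  obtain ⟨j, hj, h⟩ := exists_ternaryThue_ne 1 one_pos n
  obtain rfl : j = 0 := by omega
  exact h

/-- A square-free and palindrome-free word on four letters, obtained from `ternaryThue` by
inserting the fourth letter before every block of two letters. -/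
def pathColour (n : ℕ) : Fin 4 :=
  if n % 3 = 0 then 3 else ternaryThue (2 * (n / 3) + n % 3 - 1)

theorem pathColour_three_mul_add_one (m : ℕ) :
    pathColour (3 * m + 1) = ternaryThue (2 * m) := by
  rw [pathColour, if_neg (by omega)]
  congr 1
  omega

theorem pathColour_three_mul_add_two (m : ℕ) :
    pathColour (3 * m + 2) = ternaryThue (2 * m + 1) := by
  rw [pathColour, if_neg (by omega)]
  congr 1
  omega

theorem pathColour_eq_three_iff (n : ℕ) : pathColour n = 3 ↔ n % 3 = 0 := by
  unfold pathColour
  split_ifs with h <;> simp [h, ternaryThue_ne_three]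

theorem pathColour_succ_ne (n : ℕ) : pathColour n ≠ pathColour (n + 1) := by
  by_cases h : n % 3 = 1
  · obtain ⟨m, rfl⟩ : ∃ m, n = 3 * m + 1 := ⟨n / 3, by omega⟩
    rw [pathColour_three_mul_add_one, pathColour_three_mul_add_two]
    exact ternaryThue_succ_ne _
  · intro e
    have h1 := pathColour_eq_three_iff n
    rw [e, pathColour_eq_three_iff] at h1
    omega

theorem pathColour_add_two_ne (n : ℕ) : pathColour n ≠ pathColour (n + 2) := by
  by_cases h : n % 3 = 2
  · obtain ⟨m, rfl⟩ : ∃ m, n = 3 * m + 2 := ⟨n / 3, by omega⟩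
    rw [show 3 * m + 2 + 2 = 3 * (m + 1) + 1 by ring, pathColour_three_mul_add_one,
      pathColour_three_mul_add_two]
    exact ternaryThue_succ_ne _
  · intro e
    have h1 := pathColour_eq_three_iff n
    rw [e, pathColour_eq_three_iff] at h1
    omega

theorem exists_pathColour_ne (p : ℕ) (hp : 0 < p) (x : ℕ) :
    ∃ i < p, pathColour (x + i) ≠ pathColour (x + i + p) := by
  by_contra! h
  by_cases h3 : p % 3 = 0
  · obtain ⟨q, rfl⟩ : ∃ q, p = 3 * q := ⟨p / 3, by omega⟩
    -- position in `pathColour` of the `n`-th letter of `ternaryThue`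
    have hpos : ∀ n, ternaryThue n = pathColour (3 * (n / 2) + n % 2 + 1) := by
      intro n
      rcases Nat.mod_two_eq_zero_or_one n with e | e <;> rw [e]
      · rw [add_zero, pathColour_three_mul_add_one]
        congr 1
        omega
      · rw [add_assoc, pathColour_three_mul_add_two]
        congr 1
        omega
    obtain ⟨j, hj, hne⟩ :=
      exists_ternaryThue_ne (2 * q) (by omega) (2 * (x / 3) + x % 3 / 2)
    generalize hn : 2 * (x / 3) + x % 3 / 2 + j = n at hne
    have := h (3 * (n / 2) + n % 2 + 1 - x) (by omega)
    rw [Nat.add_sub_cancel' (by omega)] at this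
    rw [hpos n, this, hpos] at hne
    refine hne (congrArg _ ?_)
    omega
  · by_cases h2 : p ≤ 2
    · have h0 := h 0 hp
      obtain rfl | rfl : p = 1 ∨ p = 2 := by omega
      · exact pathColour_succ_ne _ h0
      · exact pathColour_add_two_ne _ h0
    · have := h ((3 - x % 3) % 3) (by omega)
      have h1 := pathColour_eq_three_iff (x + (3 - x % 3) % 3)
      rw [this, pathColour_eq_three_iff] at h1
      omega

/-- Two natural numbers at distance at most one. -/
def LazyStep (a b : ℕ) : Prop := a ≤ b + 1 ∧ b ≤ a + 1

theorem LazyStep.eq_or {a b : ℕ} (h : LazyStep a b) : a = b ∨ b = a + 1 ∨ a = b + 1 := by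
  unfold LazyStep at h
  omega

theorem LazyStep.eq_of_pathColour_eq {a b : ℕ} (h : LazyStep a b)
    (hc : pathColour a = pathColour b) : a = b := by
  rcases h.eq_or with rfl | rfl | rfl
  · rfl
  · exact (pathColour_succ_ne _ hc).elim
  · exact (pathColour_succ_ne _ hc.symm).elim

theorem eq_of_pathColour_eq_of_le {a b : ℕ} (h1 : a ≤ b + 2) (h2 : b ≤ a + 2)
    (hc : pathColour a = pathColour b) : a = b := by
  by_contra hne
  obtain rfl | rfl | rfl | rfl : b = a + 1 ∨ b = a + 2 ∨ a = b + 1 ∨ a = b + 2 := by omega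
  · exact pathColour_succ_ne _ hc
  · exact pathColour_add_two_ne _ hc
  · exact pathColour_succ_ne _ hc.symm
  · exact pathColour_add_two_ne _ hc.symm

/-- The walk with halves `f` and `g`, each of length `n`, is lazy and repetitive for
`pathColour`. -/
structure IsRepetitivePair (f g : ℕ → ℕ) (n : ℕ) : Prop where
  left : ∀ j, j + 1 < n → LazyStep (f j) (f (j + 1))
  right : ∀ j, j + 1 < n → LazyStep (g j) (g (j + 1))
  middle : LazyStep (f (n - 1)) (g 0)
  colour : ∀ j < n, pathColour (f j) = pathColour (g j)

namespace IsRepetitivePair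

variable {f g : ℕ → ℕ} {n : ℕ}

theorem cut (h : IsRepetitivePair f g n) {i m : ℕ} (hi : i + m < n) (hf : f i = f (i + m))
    (hg : g i = g (i + m)) :
    IsRepetitivePair (fun j => if j ≤ i then f j else f (j + m))
      (fun j => if j ≤ i then g j else g (j + m)) (n - m) := by
  have step : ∀ u : ℕ → ℕ, (∀ j, j + 1 < n → LazyStep (u j) (u (j + 1))) →
      u i = u (i + m) → ∀ j, j + 1 < n - m →
      LazyStep (if j ≤ i then u j else u (j + m))
        (if j + 1 ≤ i then u (j + 1) else u (j + 1 + m)) := by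
    intro u hu hi j hj
    rcases lt_trichotomy j i with hlt | rfl | hlt
    · rw [if_pos (by omega), if_pos (by omega)]
      exact hu j (by omega)
    · rw [if_pos le_rfl, if_neg (by omega), hi, add_right_comm]
      exact hu _ (by omega)
    · rw [if_neg (by omega), if_neg (by omega), add_right_comm]
      exact hu _ (by omega)
  refine ⟨step f h.left hf, step g h.right hg, ?_, fun j hj => ?_⟩
  · have : (if n - m - 1 ≤ i then f (n - m - 1) else f (n - m - 1 + m)) = f (n - 1) := by
      split_ifs with h'
      · rw [show n - m - 1 = i by omega, hf, show i + m = n - 1 by omega]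
      · rw [show n - m - 1 + m = n - 1 by omega]
    rw [this, if_pos (Nat.zero_le _)]
    exact h.middle
  · split_ifs
    · exact h.colour j (by omega)
    · exact h.colour _ (by omega)

/-- A lazy walk on the path without stationary steps or turns is monotone. -/
theorem monotone_of_no_turn {f : ℕ → ℕ} {n : ℕ}
    (hf : ∀ j, j + 1 < n → LazyStep (f j) (f (j + 1)))
    (h1 : ∀ j, j + 1 < n → f j ≠ f (j + 1)) (h2 : ∀ j, j + 2 < n → f j ≠ f (j + 2)) :
    (∀ j < n, f j = f 0 + j) ∨ (∀ j < n, f j + j = f 0) := by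
  by_cases hn : n ≤ 1
  · refine Or.inl fun j hj => ?_
    obtain rfl : j = 0 := by omega
    rfl
  rcases (hf 0 (by omega)).eq_or with h | h | h
  · exact (h1 0 (by omega) h).elim
  · have key : ∀ j, j + 1 < n → f j = f 0 + j ∧ f (j + 1) = f 0 + (j + 1) := by
      intro j
      induction j with
      | zero => exact fun _ => ⟨rfl, h⟩
      | succ j ih =>
        intro hj
        have := ih (by omega)
        have := hf (j + 1) hj
        have := h1 (j + 1) hj
        have := h2 j hj
        unfold LazyStep at *
        exact ⟨by omega, by grind⟩
    refine Or.inl fun j hj => ?_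
    rcases j with _ | j
    · rfl
    · exact (key j hj).2
  · have key : ∀ j, j + 1 < n → f j + j = f 0 ∧ f (j + 1) + (j + 1) = f 0 := by
      intro j
      induction j with
      | zero => exact fun _ => ⟨rfl, h.symm⟩
      | succ j ih =>
        intro hj
        have := ih (by omega)
        have := hf (j + 1) hj
        have := h1 (j + 1) hj
        have := h2 j hj
        unfold LazyStep at *
        exact ⟨by omega, by grind⟩
    refine Or.inr fun j hj => ?_
    rcases j with _ | j
    · rfl
    · exact (key j hj).2

/-- In two equally coloured lazy walks, stationary steps and turns occur at the same time. -/
theorem return_of_return {f g : ℕ → ℕ} {n : ℕ}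
    (hg : ∀ j, j + 1 < n → LazyStep (g j) (g (j + 1)))
    (hc : ∀ j < n, pathColour (f j) = pathColour (g j)) {i m : ℕ} (hm : m ≤ 2)
    (hi : i + m < n) (hf : f i = f (i + m)) : g i = g (i + m) := by
  have hstep : g i ≤ g (i + m) + 2 ∧ g (i + m) ≤ g i + 2 := by
    obtain rfl | rfl | rfl : m = 0 ∨ m = 1 ∨ m = 2 := by omega
    · simp
    · have := hg i hi
      unfold LazyStep at this
      omega
    · have h1 := hg i (by omega)
      have h2 := hg (i + 1) hi
      rw [add_assoc, one_add_one_eq_two] at h2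
      unfold LazyStep at h1 h2
      omega
  refine eq_of_pathColour_eq_of_le hstep.1 hstep.2 ?_
  rw [← hc i (by omega), ← hc (i + m) hi, hf]

theorem zero_eq_of_monotone (h : IsRepetitivePair f g n) (hn : 2 ≤ n)
    (hf : (∀ j < n, f j = f 0 + j) ∨ (∀ j < n, f j + j = f 0))
    (hg : (∀ j < n, g j = g 0 + j) ∨ (∀ j < n, g j + j = g 0)) : f 0 = g 0 := by
  have hm := h.middle
  unfold LazyStep at hm
  by_contra hne
  rcases hf with hf | hf <;> rcases hg with hg | hg
  · have h0 := hf (n - 1) (by omega)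
    obtain ⟨i, hi, hc⟩ := exists_pathColour_ne (g 0 - f 0) (by omega) (f 0)
    refine hc ?_
    have := h.colour i (by omega)
    rwa [hf i (by omega), hg i (by omega),
      show g 0 + i = f 0 + i + (g 0 - f 0) by omega] at this
  · have h0 := hf (n - 1) (by omega)
    have e1 := hf ((g 0 - f 0 - 1) / 2) (by omega)
    have e2 := hg ((g 0 - f 0 - 1) / 2) (by omega)
    have := eq_of_pathColour_eq_of_le (by omega) (by omega)
      (h.colour ((g 0 - f 0 - 1) / 2) (by omega))
    omega
  · have h0 := hf (n - 1) (by omega)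
    have e1 := hf ((f 0 - g 0 - 1) / 2) (by omega)
    have e2 := hg ((f 0 - g 0 - 1) / 2) (by omega)
    have := eq_of_pathColour_eq_of_le (by omega) (by omega)
      (h.colour ((f 0 - g 0 - 1) / 2) (by omega))
    omega
  · have h0 := hf (n - 1) (by omega)
    have h1 := hg (n - 1) (by omega)
    obtain ⟨i, hi, hc⟩ :=
      exists_pathColour_ne (f 0 - g 0) (by omega) (g 0 - (f 0 - g 0 - 1))
    refine hc ?_
    have e1 := hf (f 0 - g 0 - 1 - i) (by omega)
    have e2 := hg (f 0 - g 0 - 1 - i) (by omega)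
    have := h.colour (f 0 - g 0 - 1 - i) (by omega)
    rw [show f (f 0 - g 0 - 1 - i) = g 0 - (f 0 - g 0 - 1) + i + (f 0 - g 0) by omega,
      show g (f 0 - g 0 - 1 - i) = g 0 - (f 0 - g 0 - 1) + i by omega] at this
    exact this.symm

theorem zero_eq (h : IsRepetitivePair f g n) (hn : 0 < n) : f 0 = g 0 := by
  induction n using Nat.strong_induction_on generalizing f g with
  | _ n ih =>
    have reduce : ∀ i m, 0 < m → i + m < n → f i = f (i + m) → g i = g (i + m) →
        f 0 = g 0 := by
      intro i m hm hi hf hg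
      simpa using ih (n - m) (by omega) (h.cut hi hf hg) (by omega)
    by_cases h1 : ∃ j, j + 1 < n ∧ f j = f (j + 1)
    · obtain ⟨j, hj, e⟩ := h1
      exact reduce j 1 one_pos hj e (return_of_return h.right h.colour one_le_two hj e)
    by_cases h2 : ∃ j, j + 2 < n ∧ f j = f (j + 2)
    · obtain ⟨j, hj, e⟩ := h2
      exact reduce j 2 two_pos hj e (return_of_return h.right h.colour le_rfl hj e)
    push Not at h1 h2
    rcases Nat.lt_or_ge 1 n with hlt | hle
    · exact h.zero_eq_of_monotone hlt (monotone_of_no_turn h.left h1 h2)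
        (monotone_of_no_turn h.right
          (fun j hj e => h1 j hj (return_of_return h.left (fun j hj => (h.colour j hj).symm)
            one_le_two hj e))
          (fun j hj e => h2 j hj (return_of_return h.left (fun j hj => (h.colour j hj).symm)
            le_rfl hj e)))
    · obtain rfl : n = 1 := by omega
      exact h.middle.eq_of_pathColour_eq (h.colour 0 hn)

theorem eq (h : IsRepetitivePair f g n) : ∀ j < n, f j = g j := by
  intro j
  induction j with
  | zero => exact h.zero_eq
  | succ j ih =>
    intro hj
    have h0 := ih (by omega)
    have h1 := h.left j hj
    have h2 := h.right j hj
    unfold LazyStep at h1 h2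
    exact eq_of_pathColour_eq_of_le (by omega) (by omega) (h.colour _ hj)

end IsRepetitivePair

namespace SimpleGraph

variable {V α : Type*} {G H : SimpleGraph V} {f : V → ℕ} {k : ℕ}

/-- Strong nonrepetitiveness in terms of the list of pairs `(vᵢ, vᵢ₊ₖ)`. -/
theorem IsStronglyNonrepetitiveColouring.of_pairs {φ : V → α}
    (h : ∀ z : List (V × V), z ≠ [] → G.IsLazyWalk (z.map Prod.fst ++ z.map Prod.snd) →
      (∀ p ∈ z, φ p.1 = φ p.2) → ∃ p ∈ z, p.1 = p.2) :
    G.IsStronglyNonrepetitiveColouring φ := by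
  intro l k hl hk hlen hrep
  have hlen' : (l.take k).length = (l.drop k).length := by grind
  have hget : ∀ i, l[i + k]? = (l.drop k)[i]? := fun i => by grind
  have hz := h ((l.take k).zip (l.drop k)) (List.ne_nil_of_length_pos (by grind)) (by
    rwa [List.map_fst_zip hlen'.le, List.map_snd_zip hlen'.ge, List.take_append_drop])
  have hcol : ∀ p ∈ (l.take k).zip (l.drop k), φ p.1 = φ p.2 := by
    intro p hp
    obtain ⟨i, hi, rfl⟩ := List.getElem_of_mem hp
    have := congrArg (·[i]?) hrep
    simp only [← List.map_take, ← List.map_drop] at this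
    grind
  obtain ⟨p, hp, e⟩ := hz hcol
  obtain ⟨i, hi, rfl⟩ := List.getElem_of_mem hp
  refine ⟨i, by grind, ?_⟩
  grind

theorem IsStronglyNonrepetitiveColouring.exists_eq {φ : V → α}
    (h : G.IsStronglyNonrepetitiveColouring φ) {z : List (V × V)} (hz : z ≠ [])
    (hw : G.IsLazyWalk (z.map Prod.fst ++ z.map Prod.snd)) (hc : ∀ p ∈ z, φ p.1 = φ p.2) :
    ∃ p ∈ z, p.1 = p.2 := by
  obtain ⟨i, hi, e⟩ := h _ z.length hw (List.length_pos_iff.2 hz) (by simp [two_mul]) (by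
    simpa using hc)
  refine ⟨z[i], by simp, ?_⟩
  rw [List.getElem?_append_left (by simpa using hi),
    List.getElem?_append_right (by simp)] at e
  simpa [hi] using e

theorem IsLazyWalk.mono (h : G ≤ H) {l : List V} (hl : G.IsLazyWalk l) : H.IsLazyWalk l :=
  List.IsChain.imp (fun _ _ => Or.imp_right (h ·)) hl

theorem IsStronglyNonrepetitiveColouring.mono {φ : V → α} (h : G ≤ H)
    (hφ : H.IsStronglyNonrepetitiveColouring φ) : G.IsStronglyNonrepetitiveColouring φ :=
  fun l k hl => hφ l k (hl.mono h)

/-- Eliminating the vertices in decreasing order of `f`, the remaining neighbours of each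
vertex form a clique on at most `k` vertices when the vertex is eliminated. -/
structure IsEliminationOrder (H : SimpleGraph V) (f : V → ℕ) (k : ℕ) : Prop where
  injective : Function.Injective f
  isClique : ∀ v, H.IsClique {u | H.Adj v u ∧ f u < f v}
  encard_le : ∀ v, {u | H.Adj v u ∧ f u < f v}.encard ≤ k

/-- The length of a shortest `f`-decreasing path from `v` to a vertex without smaller
neighbours. -/
noncomputable def elimLayer (H : SimpleGraph V) (f : V → ℕ) (v : V) : ℕ :=
  sInf (Set.range fun u : {u // H.Adj v u ∧ f u < f v} => elimLayer H f u + 1)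
termination_by f v
decreasing_by exact u.2.2

theorem elimLayer_le {u v : V} (h : H.Adj v u) (hlt : f u < f v) :
    H.elimLayer f v ≤ H.elimLayer f u + 1 := by
  rw [elimLayer]
  exact Nat.sInf_le ⟨⟨u, h, hlt⟩, rfl⟩

theorem exists_elimLayer_eq {u v : V} (h : H.Adj v u) (hlt : f u < f v) :
    ∃ w, H.Adj v w ∧ f w < f v ∧ H.elimLayer f v = H.elimLayer f w + 1 := by
  rw [elimLayer]
  obtain ⟨w, hw⟩ := Nat.sInf_mem
    (s := Set.range fun u : {u // H.Adj v u ∧ f u < f v} => H.elimLayer f u + 1)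
    ⟨_, ⟨⟨u, h, hlt⟩, rfl⟩⟩
  exact ⟨w, w.2.1, w.2.2, hw.symm⟩

/-- The subgraph formed by the edges inside the layers of `ℓ`. -/
def withinLayers (H : SimpleGraph V) (ℓ : V → ℕ) : SimpleGraph V where
  Adj u v := H.Adj u v ∧ ℓ u = ℓ v
  symm := ⟨fun _ _ h => ⟨h.1.symm, h.2.symm⟩⟩
  loopless := ⟨fun _ h => h.1.ne rfl⟩

namespace IsEliminationOrder

theorem elimLayer_mono (h : H.IsEliminationOrder f k) {u v : V} (ha : H.Adj v u)
    (hlt : f u < f v) : H.elimLayer f u ≤ H.elimLayer f v := by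
  induction hn : f v using Nat.strong_induction_on generalizing u v with
  | _ n ih =>
    obtain ⟨w, hw, hwlt, e⟩ := exists_elimLayer_eq ha hlt
    rw [e]
    by_cases huw : u = w
    · exact huw ▸ Nat.le_succ _
    have hadj : H.Adj u w := h.isClique v ⟨ha, hlt⟩ ⟨hw, hwlt⟩ huw
    rcases lt_or_gt_of_ne (h.injective.ne huw) with hl | hl
    · exact (ih _ (hn ▸ hwlt) hadj.symm hl rfl).trans (Nat.le_succ _)
    · exact elimLayer_le hadj hl

theorem lazyStep (h : H.IsEliminationOrder f k) {u v : V} (ha : u = v ∨ H.Adj u v) :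
    LazyStep (H.elimLayer f u) (H.elimLayer f v) := by
  unfold LazyStep
  rcases ha with rfl | ha
  · omega
  rcases lt_or_gt_of_ne (h.injective.ne ha.ne) with hl | hl
  · have := h.elimLayer_mono ha.symm hl
    have := elimLayer_le ha.symm hl
    omega
  · have := h.elimLayer_mono ha hl
    have := elimLayer_le ha hl
    omega

theorem withinLayers (h : H.IsEliminationOrder f (k + 1)) :
    (H.withinLayers (H.elimLayer f)).IsEliminationOrder f k where
  injective := h.injective
  isClique v a ha b hb hab :=
    ⟨h.isClique v ⟨ha.1.1, ha.2⟩ ⟨hb.1.1, hb.2⟩ hab, ha.1.2.symm.trans hb.1.2⟩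
  encard_le v := by
    rcases Set.eq_empty_or_nonempty {u | H.Adj v u ∧ f u < f v} with he | ⟨u, hu⟩
    · refine le_trans (Set.encard_le_encard (t := {u | H.Adj v u ∧ f u < f v})
        fun u hu => ⟨hu.1.1, hu.2⟩) ?_
      simp [he]
    · obtain ⟨w, hw, hwlt, e⟩ := exists_elimLayer_eq hu.1 hu.2
      have hle := h.encard_le v
      rw [← Set.encard_sdiff_singleton_add_one
        (show w ∈ {u | H.Adj v u ∧ f u < f v} from ⟨hw, hwlt⟩)] at hle
      push_cast at hle
      refine le_trans (Set.encard_le_encard ?_)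
        ((ENat.add_le_add_iff_right ENat.one_ne_top).1 hle)
      rintro x ⟨⟨hx, hxe⟩, hxlt⟩
      refine ⟨⟨hx, hxlt⟩, ?_⟩
      rintro rfl
      omega

/-- In a lazy walk staying in layers at least `d`, the vertices in layer `d` form a lazy
walk. -/
theorem isLazyWalk_filter (h : H.IsEliminationOrder f k) {d : ℕ} {l : List V}
    (hl : H.IsLazyWalk l) (hd : ∀ v ∈ l, d ≤ H.elimLayer f v) :
    H.IsLazyWalk (l.filter fun v => H.elimLayer f v = d) := by
  induction hn : l.length using Nat.strong_induction_on generalizing l with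
  | _ n ih =>
    by_cases hall : ∀ v ∈ l, H.elimLayer f v = d
    · rwa [List.filter_eq_self.2 (by simpa using hall)]
    obtain ⟨M, ⟨hM, hMd⟩, hmax⟩ :
        ∃ M, (M ∈ l ∧ d < H.elimLayer f M) ∧
          ∀ v, (v ∈ l ∧ d < H.elimLayer f v) → f v ≤ f M := by
      push Not at hall
      obtain ⟨v, hv, hvd⟩ := hall
      have hfin : {v | v ∈ l ∧ d < H.elimLayer f v}.Finite :=
        (List.finite_toSet l).subset fun v hv => hv.1
      obtain ⟨M, hM, hmax⟩ := hfin.exists_maximalFor f _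
        ⟨v, hv, lt_of_le_of_ne (hd v hv) (Ne.symm hvd)⟩
      refine ⟨M, hM, fun v hv => ?_⟩
      rcases le_total (f v) (f M) with hle | hle
      · exact hle
      · exact hmax hv hle
    have hnbr : ∀ x ∈ l, (x = M ∨ H.Adj x M) → x = M ∨ (H.Adj M x ∧ f x < f M) := by
      rintro x hx (rfl | ha)
      · exact Or.inl rfl
      refine Or.inr ⟨ha.symm, lt_of_le_of_ne ?_ (h.injective.ne ha.ne)⟩
      by_contra! hlt
      have h1 := h.elimLayer_mono ha hlt
      exact hlt.not_ge (hmax x ⟨hx, by omega⟩)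
    obtain ⟨a, b, rfl⟩ := List.append_of_mem hM
    have hab : H.IsLazyWalk (a ++ b) := by
      unfold IsLazyWalk at hl ⊢
      rw [List.Chain', List.isChain_append] at hl ⊢
      obtain ⟨h1, h2, h3⟩ := hl
      rw [List.isChain_cons] at h2
      refine ⟨h1, h2.2, fun x hx y hy => ?_⟩
      have hxM := hnbr x (by grind) (h3 x hx M (by simp))
      have hyM := hnbr y (by grind) (by simpa [eq_comm, H.adj_comm] using h2.1 y hy)
      rcases hxM with rfl | hxM
      · exact h2.1 y hy
      rcases hyM with rfl | hyM
      · exact h3 x hx _ (by simp)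
      rw [or_iff_not_imp_left]
      exact h.isClique M hxM hyM
    have := ih (a ++ b).length (by grind) hab (by grind) rfl
    rwa [List.filter_append, List.filter_cons_of_neg (by simpa using hMd.ne'),
      ← List.filter_append]

/-- Equal path colours of the layers along a lazy walk force equal layers. -/
theorem elimLayer_eq (h : H.IsEliminationOrder f k) {z : List (V × V)}
    (hw : H.IsLazyWalk (z.map Prod.fst ++ z.map Prod.snd))
    (hc : ∀ p ∈ z, pathColour (H.elimLayer f p.1) = pathColour (H.elimLayer f p.2)) :
    ∀ p ∈ z, H.elimLayer f p.1 = H.elimLayer f p.2 := by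
  intro p hp
  unfold IsLazyWalk at hw
  rw [List.Chain', List.isChain_append, List.isChain_iff_getElem,
    List.isChain_iff_getElem] at hw
  obtain ⟨h1, h2, h3⟩ := hw
  have hpos : 0 < z.length := List.length_pos_of_mem hp
  have key : IsRepetitivePair (fun j => H.elimLayer f (z.getD j p).1)
      (fun j => H.elimLayer f (z.getD j p).2) z.length := by
    refine ⟨fun j hj => h.lazyStep ?_, fun j hj => h.lazyStep ?_, h.lazyStep ?_,
      fun j hj => hc _ ?_⟩
    · have := h1 j (by simpa using hj)
      grind
    · have := h2 j (by simpa using hj)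
      grind
    · refine h3 _ ?_ _ ?_
      · grind
      · rw [List.head?_eq_getElem?]
        grind
    · grind
  obtain ⟨i, hi, rfl⟩ := List.getElem_of_mem hp
  simpa [hi] using key.eq i hi

theorem isStronglyNonrepetitiveColouring (h : H.IsEliminationOrder f k) {φ : V → α}
    (hφ : (H.withinLayers (H.elimLayer f)).IsStronglyNonrepetitiveColouring φ) :
    H.IsStronglyNonrepetitiveColouring fun v => (φ v, pathColour (H.elimLayer f v)) := by
  refine .of_pairs fun z hz hw hc => ?_
  simp only [Prod.mk.injEq] at hc
  have hℓ := h.elimLayer_eq hw fun p hp => (hc p hp).2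
  obtain ⟨m, hm, hmin⟩ : ∃ m ∈ z, ∀ p ∈ z, H.elimLayer f m.1 ≤ H.elimLayer f p.1 := by
    obtain ⟨m, hm, hmin⟩ := (List.finite_toSet z).exists_minimalFor
      (fun p => H.elimLayer f p.1) _ (List.exists_mem_of_ne_nil z hz)
    exact ⟨m, hm, fun p hp => (le_total _ _).elim id (hmin hp)⟩
  set d := H.elimLayer f m.1 with hd
  set z' := z.filter fun p => H.elimLayer f p.1 = d
  have hfilter := h.isLazyWalk_filter hw (d := d) (by
    simp only [List.mem_append, List.mem_map]
    rintro v (⟨p, hp, rfl⟩ | ⟨p, hp, rfl⟩)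
    · exact hmin p hp
    · exact hℓ p hp ▸ hmin p hp)
  have hsplit : (z.map Prod.fst ++ z.map Prod.snd).filter (fun v => H.elimLayer f v = d) =
      z'.map Prod.fst ++ z'.map Prod.snd := by
    rw [List.filter_append, List.filter_map, List.filter_map]
    congr 2
    refine List.filter_congr fun p hp => ?_
    simp [hℓ p hp]
  have hmem : ∀ v ∈ z'.map Prod.fst ++ z'.map Prod.snd, H.elimLayer f v = d := by
    intro v hv
    rw [← hsplit] at hv
    simpa using (List.mem_filter.1 hv).2
  have hlazy : (H.withinLayers (H.elimLayer f)).IsLazyWalk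
      (z'.map Prod.fst ++ z'.map Prod.snd) := by
    rw [hsplit] at hfilter
    exact List.IsChain.imp_of_mem_imp (fun a b ha hb => Or.imp_right fun hab =>
      ⟨hab, (hmem a ha).trans (hmem b hb).symm⟩) hfilter
  obtain ⟨p, hp, e⟩ := hφ.exists_eq
    (List.ne_nil_of_mem (List.mem_filter.2 ⟨hm, by simp [hd]⟩)) hlazy
    fun p hp => (hc p (List.mem_filter.1 hp).1).1
  exact ⟨p, (List.mem_filter.1 hp).1, e⟩

theorem exists_colouring (h : H.IsEliminationOrder f k) :
    ∃ φ : V → Fin (4 ^ k), H.IsStronglyNonrepetitiveColouring φ := by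
  induction k generalizing H with
  | zero =>
    have hadj : ∀ u v, ¬ H.Adj u v := by
      have hlow : ∀ u v, H.Adj v u → ¬ f u < f v := by
        intro u v ha hlt
        have := h.encard_le v
        rw [Nat.cast_zero, nonpos_iff_eq_zero, Set.encard_eq_zero] at this
        exact Set.eq_empty_iff_forall_notMem.1 this u ⟨ha, hlt⟩
      intro u v ha
      rcases lt_or_gt_of_ne (h.injective.ne ha.ne) with hl | hl
      · exact hlow _ _ ha.symm hl
      · exact hlow _ _ ha hl
    refine ⟨fun _ => ⟨0, by simp⟩, .of_pairs fun z hz hw _ => ?_⟩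
    have heq : (z.map Prod.fst ++ z.map Prod.snd).Pairwise (· = ·) :=
      List.isChain_iff_pairwise.1 (List.IsChain.imp (fun a b hab => by simpa [hadj] using hab) hw)
    obtain ⟨p, hp⟩ := List.exists_mem_of_ne_nil z hz
    exact ⟨p, hp, (List.pairwise_append.1 heq).2.2 _ (List.mem_map_of_mem hp) _
      (List.mem_map_of_mem hp)⟩
  | succ k ih =>
    obtain ⟨φ, hφ⟩ := ih h.withinLayers
    have := h.isStronglyNonrepetitiveColouring hφ
    refine ⟨fun v => finProdFinEquiv (φ v, pathColour (H.elimLayer f v)), .of_pairs ?_⟩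
    intro z hz hw hc
    exact this.exists_eq hz hw fun p hp => finProdFinEquiv.injective (hc p hp)

end IsEliminationOrder

theorem Connected.exists_isPath_forall_mem {S : Set V} (hS : (G.induce S).Connected)
    {s x : V} (hs : s ∈ S) (hx : x ∈ S) :
    ∃ q : G.Walk s x, q.IsPath ∧ ∀ y ∈ q.support, y ∈ S := by
  obtain ⟨q, hq⟩ := hS.exists_isPath ⟨s, hs⟩ ⟨x, hx⟩
  refine ⟨q.map (Embedding.induce S).toHom, hq.map Subtype.val_injective, fun y hy => ?_⟩
  have hmem : y ∈ q.support.map (Embedding.induce S).toHom :=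
    Walk.support_map (Embedding.induce S).toHom q ▸ hy
  obtain ⟨a, -, rfl⟩ := List.mem_map.1 hmem
  exact a.2

/-- In a tree rooted at `r`, every walk from `r` to a connected set passes through its vertex
closest to `r`. -/
theorem IsTree.mem_support_of_forall_dist_le {T : Type*} {Tg : SimpleGraph T} (hT : Tg.IsTree)
    {r s x : T} {S : Set T} (hS : (Tg.induce S).Connected) (hs : s ∈ S)
    (hmin : ∀ y ∈ S, Tg.dist r s ≤ Tg.dist r y) (hx : x ∈ S) (w : Tg.Walk r x) :
    s ∈ w.support := by
  classical
  obtain ⟨q₁, hq₁, hlen⟩ := hT.connected.exists_path_of_dist r s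
  obtain ⟨q₂, hq₂p, hq₂S⟩ := hS.exists_isPath_forall_mem hs hx
  have hpath : (q₁.append q₂).IsPath := by
    rw [Walk.isPath_def, Walk.support_append]
    refine List.nodup_append.2 ⟨hq₁.support_nodup, hq₂p.support_nodup.tail, ?_⟩
    rintro y hy _ hy' rfl
    have h1 := hmin y (hq₂S y (List.mem_of_mem_tail hy'))
    have h2 := dist_le (q₁.takeUntil y hy)
    have hys : y ≠ s := by
      rintro rfl
      have := hq₂p.support_nodup
      rw [← Walk.cons_tail_support] at this
      exact (List.nodup_cons.1 this).1 hy'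
    have h3 := Walk.length_takeUntil_lt_length hy hys
    omega
  have : w.bypass = q₁.append q₂ :=
    congrArg Subtype.val ((hT.isAcyclic.subsingleton_path r x).elim ⟨_, w.bypass_isPath⟩ ⟨_, hpath⟩)
  refine w.support_bypass_subset_support ?_
  rw [this, Walk.mem_support_append_iff]
  exact Or.inl q₁.end_mem_support

/-- In a tree rooted at `r`, if two intersecting connected sets have closest vertices `s`, `t` to
`r`, the vertex farther from `r` lies in both sets. -/
theorem IsTree.mem_of_dist_le {T : Type*} {Tg : SimpleGraph T} (hT : Tg.IsTree)
    {r s t x : T} {S S' : Set T} (hS : (Tg.induce S).Connected)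
    (hS' : (Tg.induce S').Connected) (hs : s ∈ S)
    (ht : t ∈ S') (hmin : ∀ y ∈ S', Tg.dist r t ≤ Tg.dist r y)
    (hx : x ∈ S) (hx' : x ∈ S') (hst : Tg.dist r s ≤ Tg.dist r t) : t ∈ S := by
  classical
  obtain ⟨q₁, hq₁, hlen⟩ := hT.connected.exists_path_of_dist r s
  obtain ⟨q₂, -, hq₂S⟩ := hS.exists_isPath_forall_mem hs hx
  have hmem := hT.mem_support_of_forall_dist_le hS' ht hmin hx' (q₁.append q₂)
  rw [Walk.mem_support_append_iff] at hmem
  rcases hmem with h | h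
  · by_cases hts : t = s
    · exact hts ▸ hs
    · have h1 := dist_le (q₁.takeUntil t h)
      have h2 := Walk.length_takeUntil_lt_length h hts
      omega
  · exact hq₂S t h

/-- The graph in which two vertices are adjacent when they share a bag. -/
def bagGraph {T : Type*} (B : T → Finset V) : SimpleGraph V where
  Adj u v := u ≠ v ∧ ∃ x, u ∈ B x ∧ v ∈ B x
  symm := ⟨fun _ _ h => ⟨h.1.symm, h.2.imp fun _ => And.symm⟩⟩
  loopless := ⟨fun _ h => h.1 rfl⟩

theorem IsTreeDecomp.exists_isEliminationOrder [Fintype V] {T : Type*} {Tg : SimpleGraph T}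
    {B : T → Finset V} (h : G.IsTreeDecomp Tg B) (hB : ∀ x, (B x).card ≤ k + 1) :
    ∃ f : V → ℕ, (bagGraph B).IsEliminationOrder f k := by
  classical
  obtain ⟨hT, hcover, -, hconn⟩ := h
  obtain ⟨r⟩ := hT.connected.nonempty
  have hex : ∀ v, ∃ x, v ∈ B x ∧ ∀ y, v ∈ B y → Tg.dist r x ≤ Tg.dist r y := by
    intro v
    obtain ⟨x, hx, hmin⟩ :=
      exists_minimalFor_of_wellFoundedLT (fun x => v ∈ B x) (Tg.dist r) (hcover v)
    exact ⟨x, hx, fun y hy => (le_total _ _).elim id (hmin hy)⟩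
  choose top htop hmin using hex
  set f : V → ℕ := fun v => Tg.dist r (top v) * Fintype.card V + Fintype.equivFin V v with hf
  have hdiv : ∀ v, f v / Fintype.card V = Tg.dist r (top v) := by
    intro v
    rw [hf]
    have hlt := (Fintype.equivFin V v).2
    dsimp only
    rw [mul_comm, Nat.mul_add_div (by omega), Nat.div_eq_of_lt hlt, add_zero]
  have hlow : ∀ u v, (bagGraph B).Adj v u → f u < f v → u ∈ B (top v) := by
    rintro u v ⟨-, x, hxv, hxu⟩ hlt
    have hle := Nat.div_le_div_right (c := Fintype.card V) hlt.le
    rw [hdiv, hdiv] at hle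
    exact hT.mem_of_dist_le (hconn u) (hconn v) (htop u) (htop v) (hmin v) hxu hxv hle
  refine ⟨f, fun u v e => ?_, fun v a ha b hb hab => ?_, fun v => ?_⟩
  · have h1 := hdiv u
    rw [e, hdiv] at h1
    simp only [hf, h1] at e
    exact (Fintype.equivFin V).injective (Fin.ext (by omega))
  · exact ⟨hab, _, hlow a v ha.1 ha.2, hlow b v hb.1 hb.2⟩
  · have hsub : {u | (bagGraph B).Adj v u ∧ f u < f v} ⊆ ((B (top v)).erase v : Finset V) := by
      intro u hu
      exact Finset.mem_coe.2 (Finset.mem_erase.2 ⟨hu.1.ne', hlow u v hu.1 hu.2⟩)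
    refine (Set.encard_le_encard hsub).trans ?_
    rw [Set.encard_coe_eq_coe_finsetCard, Finset.card_erase_of_mem (htop v)]
    exact_mod_cast Nat.sub_le_iff_le_add.2 (hB _)

end SimpleGraph

/-- **Theorem 5.** For every `k ≥ 0`, every graph `G` of treewidth at most `k` satisfies
`π*(G) ≤ 4 ^ k`. -/
theorem strongNonrepChromNum_le_of_treewidth (k : ℕ) (V : Type) [Fintype V]
    (G : SimpleGraph V) (h : G.HasTreewidthAtMost k) :
    G.strongNonrepChromNum ≤ 4 ^ k := by
  obtain ⟨T, Tg, B, hdec, hB⟩ := h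
  obtain ⟨f, hf⟩ := hdec.exists_isEliminationOrder hB
  obtain ⟨φ, hφ⟩ := hf.exists_colouring
  have hle : G ≤ SimpleGraph.bagGraph B := fun u v ha => ⟨ha.ne, hdec.2.2.1 ha⟩
  exact Nat.sInf_le ⟨φ, hφ.mono hle⟩
end

section
/- Let k ≥ 1, let G be a connected chordal graph with clique number at most k+1 (equivalently, treewidth at most k), and let (V_0,V_1,…) be a BFS layering of G. Then for every i ≥ 0, the induced subgraph G[V_i] has treewidth at most k−1. -/
/-- A graph is *chordal* if every cycle of length at least `4` has a chord: two vertices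
of the cycle that are adjacent in the graph but not along an edge of the cycle. -/
def SimpleGraph.IsChordal {V : Type*} (G : SimpleGraph V) : Prop :=
  ∀ ⦃v : V⦄ (c : G.Walk v v), c.IsCycle → 4 ≤ c.length →
    ∃ u w : V, u ∈ c.support ∧ w ∈ c.support ∧ G.Adj u w ∧ s(u, w) ∉ c.edges

namespace SimpleGraph

open Classical in
/-- In a chordal graph, two distinct neighbours `x`, `y` of a vertex `v` are adjacent as soon as
they are joined by a walk which avoids `v` and whose only vertices adjacent to `v` are `x`, `y`. -/
theorem IsChordal.adj_of_walk {V : Type*} {G : SimpleGraph V} (hG : G.IsChordal) {v x y : V}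
    (hx : G.Adj v x) (hy : G.Adj v y) (hxy : x ≠ y) (p : G.Walk x y)
    (hv : v ∉ p.support) (hp : ∀ z ∈ p.support, G.Adj v z → z = x ∨ z = y) : G.Adj x y := by
  by_contra hnadj
  induction hn : p.length using Nat.strong_induction_on generalizing p with
  | _ n ih =>
  subst hn
  have improve (q : G.Walk x y) (hlen : q.length < p.length)
      (hq : ∀ z ∈ q.support, z ∈ p.support) : False :=
    ih q.length hlen q (fun h ↦ hv (hq v h)) (fun z hz ↦ hp z (hq z hz)) rfl
  have hpath : p.IsPath := by
    by_contra hpath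
    refine improve p.bypass ?_ p.support_bypass_subset_support
    refine lt_of_le_of_ne p.length_bypass_le_length fun h ↦ hpath ?_
    rw [← p.bypass_eq_self_of_length_le_length_bypass h.ge]
    exact p.bypass_isPath
  have shortcut {i j : ℕ} (hij : i < j) (hj : j ≤ p.length)
      (hadj : G.Adj (p.getVert i) (p.getVert j)) :
      s(p.getVert i, p.getVert j) ∈ p.edges := by
    by_contra hne
    have hij' : i + 1 < j := by
      refine lt_of_le_of_ne hij fun h ↦ hne ?_
      subst h
      exact p.mk_mem_edges_iff_exists.2 ⟨i, by omega, rfl⟩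
    refine improve ((p.take i).append (.cons hadj (p.drop j))) ?_ fun z hz ↦ ?_
    · simp [Walk.length_append]
      omega
    · rw [Walk.mem_support_append_iff, Walk.support_cons, List.mem_cons] at hz
      rcases hz with hz | rfl | hz
      · exact (p.isSubwalk_take i).support_subset hz
      · exact p.getVert_mem_support i
      · exact (p.isSubwalk_drop j).support_subset hz
  have chord_mem {s t : V} (hs : s ∈ p.support) (ht : t ∈ p.support) (hst : G.Adj s t) :
      s(s, t) ∈ p.edges := by
    obtain ⟨i, rfl, hi⟩ := Walk.mem_support_iff_exists_getVert.1 hs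
    obtain ⟨j, rfl, hj⟩ := Walk.mem_support_iff_exists_getVert.1 ht
    rcases lt_trichotomy i j with h | rfl | h
    · exact shortcut h hj hst
    · exact absurd rfl hst.ne
    · rw [Sym2.eq_swap]
      exact shortcut h hi hst.symm
  have h2 : 2 ≤ p.length := by
    by_contra! h
    cases p with
    | nil => exact hxy rfl
    | cons hadj q =>
      cases q with
      | nil => exact hnadj hadj
      | cons => simp at h
  have hvx : s(v, x) ∉ (p.concat hy.symm).edges := by
    rw [Walk.edges_concat, List.concat_eq_append, List.mem_append, List.mem_singleton]
    rintro (h | h)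
    · exact hv (p.fst_mem_support_of_mem_edges h)
    · rw [Sym2.eq_swap, Sym2.congr_left] at h
      exact hxy h
  obtain ⟨s, t, hs, ht, hst, hchord⟩ :=
    hG _ (Path.cons_isCycle ⟨_, hpath.concat hv hy.symm⟩ hx hvx) (by simp; omega)
  simp only [Walk.support_cons, Walk.support_concat, Walk.edges_cons, Walk.edges_concat,
    List.concat_eq_append, List.mem_cons, List.mem_append, List.not_mem_nil, or_false] at hs ht hchord
  push Not at hchord
  have hvs : s ≠ v → s ∈ p.support := by tauto
  have hvt : t ≠ v → t ∈ p.support := by tauto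
  by_cases hsv : s = v
  · subst hsv
    rcases hp t (hvt hst.ne') hst with rfl | rfl
    · exact hchord.1 rfl
    · exact hchord.2.2 Sym2.eq_swap
  by_cases htv : t = v
  · subst htv
    rcases hp s (hvs hst.ne) hst.symm with rfl | rfl
    · exact hchord.1 Sym2.eq_swap
    · exact hchord.2.2 rfl
  exact hchord.2.1 (chord_mem (hvs hsv) (hvt htv) hst)

/-- The graph obtained from a graph on `T` by attaching the new vertex `none` to `t`. -/
def addLeaf {T : Type*} (Tg : SimpleGraph T) (t : T) : SimpleGraph (Option T) :=
  Tg.map Function.Embedding.some ⊔ edge none (some t)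

theorem addLeaf_adj_some {T : Type*} {Tg : SimpleGraph T} {t a b : T} (h : Tg.Adj a b) :
    (Tg.addLeaf t).Adj (some a) (some b) :=
  Or.inl ((map_adj ..).2 ⟨a, b, h, rfl, rfl⟩)

theorem addLeaf_adj_none {T : Type*} (Tg : SimpleGraph T) (t : T) :
    (Tg.addLeaf t).Adj none (some t) := by
  right; simp [edge_adj]

theorem IsTree.addLeaf {T : Type*} [Finite T] {Tg : SimpleGraph T} (h : Tg.IsTree) (t : T) :
    (Tg.addLeaf t).IsTree := by
  rw [isTree_iff_connected_and_card] at h ⊢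
  obtain ⟨hc, hcard⟩ := h
  constructor
  · rw [connected_iff_exists_forall_reachable]
    refine ⟨some t, ?_⟩
    rintro (_ | a)
    · exact (addLeaf_adj_none Tg t).symm.reachable
    · exact (hc t a).map (⟨some, addLeaf_adj_some⟩ : Tg →g Tg.addLeaf t)
  · rw [Finite.card_option, ← hcard, SimpleGraph.addLeaf, edgeSet_sup, edgeSet_edge_of_ne (by simp),
      Set.union_singleton, Nat.card_coe_set_eq, Set.ncard_insert_of_notMem]
    · rw [edgeSet_map, Set.ncard_image_of_injective _ (Function.Embedding.injective _)]
      rfl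
    · rw [mem_edgeSet, map_adj]
      simp


/-- In a chordal graph, a finite set `S` of vertices which is larger than a given clique `K`
contains a vertex outside `K` that is simplicial in the subgraph induced by `S`. -/
theorem IsChordal.exists_isClique_neighborSet_inter {V : Type*} {G : SimpleGraph V}
    (hG : G.IsChordal) {S : Set V} (hS : S.Finite) {K : Set V} (hKS : K ⊂ S) (hK : G.IsClique K) :
    ∃ s ∈ S, s ∉ K ∧ G.IsClique (G.neighborSet s ∩ S) := by
  induction hn : S.ncard using Nat.strong_induction_on generalizing S K with
  | _ n ih =>
  subst hn
  by_cases hSc : G.IsClique S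
  · obtain ⟨s, hs, hsK⟩ := Set.exists_of_ssubset hKS
    exact ⟨s, hs, hsK, hSc.subset Set.inter_subset_right⟩
  obtain ⟨v, hvS, hKv, h₀, hh₀S, hh₀v, hvh₀⟩ : ∃ v ∈ S, (∀ x ∈ K, x = v ∨ G.Adj v x) ∧
      ∃ h₀ ∈ S, h₀ ≠ v ∧ ¬ G.Adj v h₀ := by
    by_cases huniv : ∃ v ∈ K, ∃ h₀ ∈ S, h₀ ≠ v ∧ ¬ G.Adj v h₀
    · obtain ⟨v, hv, h⟩ := huniv
      exact ⟨v, hKS.subset hv, fun x hx ↦ or_iff_not_imp_left.2 fun hxv ↦ hK hv hx (Ne.symm hxv), h⟩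
    · push Not at huniv
      simp only [IsClique, Set.Pairwise] at hSc
      push Not at hSc
      obtain ⟨v, hv, h₀, hh₀, hne, hadj⟩ := hSc
      exact ⟨v, hv, fun x hx ↦ or_iff_not_imp_left.2 fun hxv ↦ (huniv x hx v hv (Ne.symm hxv)).symm,
        h₀, hh₀, hne.symm, hadj⟩
  let H : Set V := {z | ∃ p : G.Walk h₀ z, ∀ w ∈ p.support, w ∈ S ∧ w ≠ v ∧ ¬ G.Adj v w}
  have hH {z : V} (hz : z ∈ H) : z ∈ S ∧ z ≠ v ∧ ¬ G.Adj v z := by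
    obtain ⟨p, hp⟩ := hz
    exact hp z p.end_mem_support
  have hh₀H : h₀ ∈ H := ⟨.nil, by simp [hh₀S, hh₀v, hvh₀]⟩
  let N : Set V := {x | x ∈ S ∧ G.Adj v x ∧ ∃ z ∈ H, G.Adj x z}
  have hNc : G.IsClique N := by
    rintro x ⟨-, hvx, z, ⟨p, hp⟩, hxz⟩ y ⟨-, hvy, z', ⟨q, hq⟩, hyz'⟩ hxy
    have hsupp {w : V} (hw : w ∈ (Walk.cons hxz ((p.reverse.append q).concat hyz'.symm)).support) :
        w = x ∨ w = y ∨ w ≠ v ∧ ¬ G.Adj v w := by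
      simp only [Walk.support_cons, Walk.support_concat, List.mem_cons, List.mem_append,
        Walk.mem_support_append_iff, Walk.support_reverse, List.mem_reverse,
        List.not_mem_nil, or_false] at hw
      rcases hw with h | (h | h) | h
      · exact Or.inl h
      · exact Or.inr (Or.inr (hp w h).2)
      · exact Or.inr (Or.inr (hq w h).2)
      · exact Or.inr (Or.inl h)
    refine hG.adj_of_walk hvx hvy hxy
      (.cons hxz ((p.reverse.append q).concat hyz'.symm)) (fun h ↦ ?_) fun w hw hvw ↦ ?_
    · rcases hsupp h with h | h | h
      · exact hvx.ne h
      · exact hvy.ne h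
      · exact h.1 rfl
    · rcases hsupp hw with h | h | h
      · exact Or.inl h
      · exact Or.inr h
      · exact absurd hvw h.2
  have hNH : N ⊂ H ∪ N :=
    (Set.ssubset_iff_of_subset Set.subset_union_right).2
      ⟨h₀, Or.inl hh₀H, fun h ↦ hvh₀ h.2.1⟩
  have hHNS : H ∪ N ⊂ S := by
    refine (Set.ssubset_iff_of_subset ?_).2 ⟨v, hvS, ?_⟩
    · rintro z (hz | hz)
      · exact (hH hz).1
      · exact hz.1
    · rintro (hv | hv)
      · exact (hH hv).2.1 rfl
      · exact hv.2.1.ne rfl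
  obtain ⟨s, hs, hsN, hsc⟩ := ih _ (Set.ncard_lt_ncard hHNS hS) (hS.subset hHNS.subset) hNH hNc rfl
  have hsH : s ∈ H := hs.resolve_right hsN
  refine ⟨s, (hH hsH).1, fun hsK ↦ ?_, hsc.subset ?_⟩
  · rcases hKv s hsK with h | h
    · exact (hH hsH).2.1 h
    · exact (hH hsH).2.2 h
  · rintro x ⟨hsx : G.Adj s x, hxS⟩
    refine ⟨hsx, ?_⟩
    by_cases hvx : G.Adj v x
    · exact Or.inr ⟨hxS, hvx, s, hsH, hsx.symm⟩
    · obtain ⟨p, hp⟩ := hsH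
      refine Or.inl ⟨p.concat hsx, fun w hw ↦ ?_⟩
      rw [Walk.support_concat, List.mem_append, List.mem_singleton] at hw
      rcases hw with hw | rfl
      · exact hp w hw
      · refine ⟨hxS, ?_, hvx⟩
        rintro rfl
        exact (hp s p.end_mem_support).2.2 hsx.symm

/-- A finite set of vertices of a chordal graph has a tree-decomposition into cliques in which
each clique is contained in some bag. -/
theorem IsChordal.exists_clique_tree {V : Type*} {G : SimpleGraph V} (hG : G.IsChordal)
    (S : Finset V) :
    ∃ (T : Type) (_ : Finite T) (Tg : SimpleGraph T) (B : T → Finset V), Tg.IsTree ∧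
      (∀ t, G.IsClique (B t : Set V)) ∧ (∀ t, B t ⊆ S) ∧
      (∀ K ⊆ S, G.IsClique (K : Set V) → ∃ t, K ⊆ B t) ∧
      ∀ v ∈ S, (Tg.induce {t | v ∈ B t}).Connected := by
  classical
  induction hn : S.card generalizing S with
  | zero =>
    obtain rfl := Finset.card_eq_zero.1 hn
    exact ⟨Unit, inferInstance, ⊥, fun _ ↦ ∅, IsTree.of_subsingleton, by simp, by simp,
      fun K hK _ ↦ ⟨(), hK⟩, by simp⟩
  | succ n ih =>
    have hne : S.Nonempty := Finset.card_pos.1 (by omega)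
    obtain ⟨s, hs, -, hclique⟩ := hG.exists_isClique_neighborSet_inter S.finite_toSet
      (K := ∅) (by simpa using hne) (by simp)
    replace hs : s ∈ S := hs
    obtain ⟨T, _, Tg, B, hT, hB, hBS, hK, hconn⟩ := ih (S.erase s)
      (by rw [Finset.card_erase_of_mem hs, hn]; rfl)
    have hsB (t : T) : s ∉ B t := fun h ↦ (Finset.mem_erase.1 (hBS t h)).1 rfl
    let N : Finset V := {x ∈ S | G.Adj s x}
    have hN : (N : Set V) = G.neighborSet s ∩ S := by
      ext x; simp [N, and_comm]
    obtain ⟨t₀, ht₀⟩ := hK N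
      (fun x hx ↦ by
        simp only [N, Finset.mem_filter] at hx
        exact Finset.mem_erase.2 ⟨hx.2.ne', hx.1⟩)
      (hN ▸ hclique)
    refine ⟨Option T, inferInstance, Tg.addLeaf t₀, fun t ↦ t.elim (insert s N) B, hT.addLeaf t₀,
      ?_, ?_, ?_, ?_⟩
    · rintro (_ | t)
      · simp only [Option.elim_none, Finset.coe_insert]
        rw [isClique_insert]
        refine ⟨hN ▸ hclique, fun b hb _ ↦ ?_⟩
        exact (Finset.mem_filter.1 (Finset.mem_coe.1 hb)).2
      · exact hB t
    · rintro (_ | t)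
      · exact Finset.insert_subset hs (Finset.filter_subset _ _)
      · exact (hBS t).trans (Finset.erase_subset _ _)
    · intro K hKS hKc
      by_cases hsK : s ∈ K
      · refine ⟨none, fun x hx ↦ ?_⟩
        by_cases hxs : x = s
        · exact hxs ▸ Finset.mem_insert_self _ _
        · exact Finset.mem_insert_of_mem
            (Finset.mem_filter.2 ⟨hKS hx, hKc hsK hx (Ne.symm hxs)⟩)
      · obtain ⟨t, ht⟩ := hK K (fun x hx ↦ Finset.mem_erase.2
          ⟨fun h ↦ hsK (h ▸ hx), hKS hx⟩) hKc
        exact ⟨some t, ht⟩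
    · intro v hv
      rw [connected_iff_exists_forall_reachable]
      by_cases hvs : v = s
      · subst hvs
        refine ⟨⟨none, Finset.mem_insert_self _ _⟩, ?_⟩
        rintro ⟨_ | t, ht⟩
        · rfl
        · exact absurd ht (hsB t)
      · have hc := hconn v (Finset.mem_erase.2 ⟨hvs, hv⟩)
        let f : Tg.induce {t | v ∈ B t} →g
            (Tg.addLeaf t₀).induce {t | v ∈ t.elim (insert s N) B} :=
          ⟨fun t ↦ ⟨some t.1, t.2⟩, fun h ↦ addLeaf_adj_some h⟩
        by_cases hvN : v ∈ N
        · refine ⟨⟨some t₀, ht₀ hvN⟩, ?_⟩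
          rintro ⟨_ | t, ht⟩
          · refine Adj.reachable ?_
            exact (addLeaf_adj_none Tg t₀).symm
          · exact (hc ⟨t₀, ht₀ hvN⟩ ⟨t, ht⟩).map f
        · obtain ⟨t₁⟩ := hc.nonempty
          refine ⟨f t₁, ?_⟩
          rintro ⟨_ | t, ht⟩
          · exact absurd (Finset.mem_of_mem_insert_of_ne ht hvs) hvN
          · exact (hc t₁ ⟨t, ht⟩).map f

/-- A vertex set in which every clique of a chordal graph has at most `k + 1` vertices induces
a subgraph of treewidth at most `k`. -/
theorem IsChordal.induce_hasTreewidthAtMost {V : Type*} {G : SimpleGraph V} (hG : G.IsChordal)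
    {S : Set V} (hS : S.Finite) {k : ℕ}
    (hk : ∀ K : Finset V, (K : Set V) ⊆ S → G.IsClique (K : Set V) → K.card ≤ k + 1) :
    (G.induce S).HasTreewidthAtMost k := by
  classical
  lift S to Finset V using hS
  obtain ⟨T, _, Tg, B, hT, hB, hBS, hK, hconn⟩ := hG.exists_clique_tree S
  refine ⟨T, Tg, fun t ↦ (B t).subtype (· ∈ (S : Set V)), ⟨hT, fun v ↦ ?_, fun u v huv ↦ ?_,
    fun v ↦ ?_⟩, fun t ↦ ?_⟩
  · obtain ⟨t, ht⟩ := hK {v.1} (by simp) (by simp)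
    exact ⟨t, by simpa using ht⟩
  · obtain ⟨t, ht⟩ := hK {u.1, v.1}
      (Finset.insert_subset u.2 (Finset.singleton_subset_iff.2 v.2))
      (by
        rw [Finset.coe_pair, isClique_pair]
        exact fun _ ↦ huv)
    simp only [Finset.insert_subset_iff, Finset.singleton_subset_iff] at ht
    exact ⟨t, by simpa using ht⟩
  · convert hconn v v.2 using 3 <;> simp
  · rw [Finset.card_subtype]
    exact (Finset.card_filter_le _ _).trans (hk _ (hBS t) (hB t))

/-- On a shortest walk from `r`, all vertices but the last are closer to `r` than the last. -/
theorem Walk.dist_lt_of_mem_support {V : Type*} {G : SimpleGraph V} {r u z : V} {p : G.Walk r u}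
    (hp : p.length = G.dist r u) (hz : z ∈ p.support) (hzu : z ≠ u) :
    G.dist r z < G.dist r u := by
  classical
  exact (dist_le (p.takeUntil z hz)).trans_lt (hp ▸ Walk.length_takeUntil_lt_length hz hzu)

/-- In a connected chordal graph, the vertices of a nonempty clique in a BFS layer other than the
root have a common neighbour in the preceding layer. -/
theorem IsChordal.exists_forall_adj_of_dist_eq {V : Type*} {G : SimpleGraph V} (hG : G.IsChordal)
    (hconn : G.Connected) {r : V} {i : ℕ} {K : Finset V}
    (hK : G.IsClique (K : Set V)) (hKi : ∀ v ∈ K, G.dist r v = i + 1) (hne : K.Nonempty) :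
    ∃ u, G.dist r u = i ∧ ∀ v ∈ K, G.Adj u v := by
  classical
  have parent (v : V) (hv : v ∈ K) : ∃ w, G.dist r w = i ∧ G.Adj w v := by
    obtain ⟨p, hp⟩ := hconn.exists_walk_length_eq_dist r v
    have hlen : p.length = i + 1 := by rw [hp, hKi v hv]
    have hnil : ¬ p.Nil := by
      rw [Walk.not_nil_iff_lt_length]; omega
    have hadj := p.adj_penultimate hnil
    refine ⟨p.penultimate, ?_, hadj⟩
    have h1 : G.dist r p.penultimate < _ := Walk.dist_lt_of_mem_support hp (p.getVert_mem_support _) hadj.ne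
    have h2 := hKi v hv
    have h3 := hconn.dist_triangle (u := r) (v := p.penultimate) (w := v)
    rw [dist_eq_one_iff_adj.2 hadj] at h3
    omega
  let d (u : V) : ℕ := {v ∈ K | G.Adj u v}.card
  obtain ⟨u, hu, hmax⟩ : ∃ u, G.dist r u = i ∧ ∀ w, G.dist r w = i → d w ≤ d u := by
    have hex : ∃ n u, G.dist r u = i ∧ K.card - d u = n := by
      obtain ⟨v, hv⟩ := hne
      obtain ⟨w, hw, -⟩ := parent v hv
      exact ⟨_, w, hw, rfl⟩
    obtain ⟨u, hu, hd⟩ := Nat.find_spec hex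
    refine ⟨u, hu, fun w hw ↦ ?_⟩
    have h1 := Nat.find_min' hex ⟨w, hw, rfl⟩
    have h2 : d w ≤ K.card := Finset.card_filter_le _ _
    have h3 : d u ≤ K.card := Finset.card_filter_le _ _
    omega
  refine ⟨u, hu, fun v hv ↦ ?_⟩
  by_contra huv
  obtain ⟨w, hw, hwv⟩ := parent v hv
  obtain ⟨x, hx, hux, hwx⟩ : ∃ x ∈ K, G.Adj u x ∧ ¬ G.Adj w x := by
    by_contra! h
    refine (hmax w hw).not_gt (Finset.card_lt_card ?_)
    rw [Finset.ssubset_iff_of_subset fun x hx ↦ ?_]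
    · exact ⟨v, by simp [hv, hwv], by simp [huv]⟩
    · rw [Finset.mem_filter] at hx ⊢
      exact ⟨hx.1, h x hx.1 hx.2⟩
  have hvx : v ≠ x := fun h ↦ huv (h ▸ hux)
  obtain ⟨p, hp⟩ := hconn.exists_walk_length_eq_dist r u
  obtain ⟨q, hq⟩ := hconn.exists_walk_length_eq_dist r w
  have hsupp {z : V} (hz : z ∈ ((p.reverse.append q).concat hwv).support) :
      z = u ∨ z = w ∨ z = v ∨ G.dist r z < i := by
    simp only [Walk.support_concat, List.mem_append,
      Walk.mem_support_append_iff, Walk.support_reverse, List.mem_reverse, List.mem_singleton] at hz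
    by_cases hzu : z = u
    · exact Or.inl hzu
    by_cases hzw : z = w
    · exact Or.inr (Or.inl hzw)
    rcases hz with (hz | hz) | rfl
    · exact Or.inr (Or.inr (Or.inr (hu ▸ Walk.dist_lt_of_mem_support hp hz hzu)))
    · exact Or.inr (Or.inr (Or.inr (hw ▸ Walk.dist_lt_of_mem_support hq hz hzw)))
    · exact Or.inr (Or.inr (Or.inl rfl))
  have hdx := hKi x hx
  refine huv (hG.adj_of_walk (v := x) hux.symm (hK hx hv hvx.symm) ?_
    ((p.reverse.append q).concat hwv) (fun h ↦ ?_) fun z hz hxz ↦ ?_)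
  · rintro rfl
    have := hKi u hv
    omega
  · rcases hsupp h with rfl | rfl | rfl | h
    · omega
    · omega
    · exact hvx rfl
    · omega
  · rcases hsupp hz with h | rfl | h | h
    · exact Or.inl h
    · exact absurd hxz.symm hwx
    · exact Or.inr h
    · have := hconn.dist_triangle (u := r) (v := z) (w := x)
      rw [dist_eq_one_iff_adj.2 hxz.symm] at this
      omega

end SimpleGraph

/-- Let `k ≥ 1`, let `G` be a connected chordal graph with clique number at most `k + 1`,
and let `(V₀, V₁, …)` be a BFS layering of `G` (from a root `r`). Then for every `i ≥ 0`,
the induced subgraph `G[Vᵢ]` has treewidth at most `k - 1`. -/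
theorem layer_hasTreewidthAtMost (V : Type) [Fintype V] (G : SimpleGraph V)
    (k : ℕ) (hk : 1 ≤ k) (hconn : G.Connected) (hchord : G.IsChordal)
    (hclique : ∀ s : Finset V, G.IsClique (s : Set V) → s.card ≤ k + 1)
    (r : V) (i : ℕ) :
    (G.induce {v : V | G.dist r v = i}).HasTreewidthAtMost (k - 1) := by
  refine hchord.induce_hasTreewidthAtMost (Set.toFinite _) fun K hKi hK ↦ ?_
  rw [Nat.sub_add_cancel hk]
  rcases K.eq_empty_or_nonempty with rfl | hne
  · simp
  cases i with
  | zero =>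
    refine (Finset.card_le_one.2 fun a ha b hb ↦ ?_).trans hk
    rw [← (hconn.dist_eq_zero_iff).1 (hKi ha), ← (hconn.dist_eq_zero_iff).1 (hKi hb)]
  | succ i =>
    classical
    obtain ⟨u, hu, hadj⟩ := hchord.exists_forall_adj_of_dist_eq hconn hK (fun v hv ↦ hKi hv) hne
    have huK : u ∉ K := fun h ↦ (hadj u h).ne rfl
    have := hclique (insert u K) (by
      rw [Finset.coe_insert, SimpleGraph.isClique_insert]
      exact ⟨hK, fun v hv _ ↦ hadj v hv⟩)
    rw [Finset.card_insert_of_notMem huK] at this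
    omega
end
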